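/- arXiv:2105.07941 — 3 statements merged into one kernel-verified Lean document; each statement's English description precedes it below -/
import Mathlib

section
/- Let R be a commutative ring, S a multiplicative subset of R, and F an R-module. The following are equivalent: (1) F is u-S-flat; (2) for every short exact sequence 0 → A → B → C → 0 of R-modules, the induced sequence 0 → A ⊗_R F → B ⊗_R F → C ⊗_R F → 0 is u-S-exact; (3) Tor_1^R(M, F) is u-S-torsion for every R-module M; (4) Tor_n^R(M, F) is u-S-torsion for every R-module M and every n ≥ 1. -/
universe u v

open CategoryTheory

/-- An `R`-module `T` is `u`-`S`-torsion if there exists `s ∈ S` with `s • T = 0`. -/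
def IsUSTorsion {R : Type u} [CommRing R] (S : Submonoid R)
    (M : Type v) [AddCommGroup M] [Module R M] : Prop :=
  ∃ s ∈ S, ∀ m : M, s • m = 0

/-- A sequence `A →f B →g C` of `R`-modules is `u`-`S`-exact at `B` if there is `s ∈ S`
with `s • ker g ⊆ im f` and `s • im f ⊆ ker g`. -/
def IsUSExactAt {R : Type u} [CommRing R] (S : Submonoid R)
    {A B C : Type*} [AddCommGroup A] [AddCommGroup B] [AddCommGroup C]
    [Module R A] [Module R B] [Module R C]
    (f : A →ₗ[R] B) (g : B →ₗ[R] C) : Prop :=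
  ∃ s ∈ S, (∀ b ∈ LinearMap.ker g, s • b ∈ LinearMap.range f) ∧
    (∀ b ∈ LinearMap.range f, s • b ∈ LinearMap.ker g)

/-- `0 → A →f B →g C → 0` is a `u`-`S`-exact sequence: `ker f` and `coker g` are
`u`-`S`-torsion and the sequence is `u`-`S`-exact at `B`. -/
def IsUSShortExact {R : Type u} [CommRing R] (S : Submonoid R)
    {A B C : Type*} [AddCommGroup A] [AddCommGroup B] [AddCommGroup C]
    [Module R A] [Module R B] [Module R C]
    (f : A →ₗ[R] B) (g : B →ₗ[R] C) : Prop :=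
  (∃ s ∈ S, ∀ a ∈ LinearMap.ker f, s • a = 0) ∧
    (∃ s ∈ S, ∀ c : C, s • c ∈ LinearMap.range g) ∧
    IsUSExactAt S f g

/-- An `R`-module `F` is `u`-`S`-flat if for every `u`-`S`-exact sequence
`0 → A → B → C → 0` the induced sequence `0 → A ⊗ F → B ⊗ F → C ⊗ F → 0` is
`u`-`S`-exact. -/
def IsUSFlat {R : Type u} [CommRing R] (S : Submonoid R)
    (F : Type v) [AddCommGroup F] [Module R F] : Prop :=
  ∀ (A B C : Type v) [AddCommGroup A] [AddCommGroup B] [AddCommGroup C]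
    [Module R A] [Module R B] [Module R C]
    (f : A →ₗ[R] B) (g : B →ₗ[R] C),
    IsUSShortExact S f g →
    IsUSShortExact S (LinearMap.rTensor F f) (LinearMap.rTensor F g)


noncomputable section USHelpers

variable {R : Type u} [CommRing R]

/-- The complex `X ⊗ P`. -/
abbrev usCx (K : ChainComplex (ModuleCat.{u} R) ℕ) (X : ModuleCat.{u} R) :
    ChainComplex (ModuleCat.{u} R) ℕ :=
  (((MonoidalCategory.tensoringLeft (ModuleCat.{u} R)).obj X).mapHomologicalComplex _).obj K

/-- The map `X ⊗ P ⟶ Y ⊗ P`. -/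
abbrev usCxMap (K : ChainComplex (ModuleCat.{u} R) ℕ) {X Y : ModuleCat.{u} R} (f : X ⟶ Y) :
    usCx K X ⟶ usCx K Y :=
  (NatTrans.mapHomologicalComplex
    ((MonoidalCategory.tensoringLeft (ModuleCat.{u} R)).map f) (ComplexShape.down ℕ)).app K

/-- The short complex of complexes `X₁ ⊗ P ⟶ X₂ ⊗ P ⟶ X₃ ⊗ P`. -/
abbrev usSC (K : ChainComplex (ModuleCat.{u} R) ℕ) (T : ShortComplex (ModuleCat.{u} R)) :
    ShortComplex (ChainComplex (ModuleCat.{u} R) ℕ) :=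
  ShortComplex.mk (usCxMap K T.f) (usCxMap K T.g) (by
    ext i : 1
    change MonoidalCategory.whiskerRight T.f (K.X i) ≫ MonoidalCategory.whiskerRight T.g (K.X i) = 0
    rw [← MonoidalCategory.comp_whiskerRight, T.zero, MonoidalPreadditive.zero_whiskerRight])

lemma usSC_shortExact (K : ChainComplex (ModuleCat.{u} R) ℕ) [∀ i, Module.Flat R (K.X i)]
    (T : ShortComplex (ModuleCat.{u} R)) (hT : T.ShortExact) : (usSC K T).ShortExact := by
  apply HomologicalComplex.shortExact_of_degreewise_shortExact
  intro i
  have h := hT.map_of_exact (MonoidalCategory.tensorRight (K.X i))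
  exact h

lemma usCx_isZero {F : ModuleCat.{u} R} (P : ProjectiveResolution F) (Q : ModuleCat.{u} R)
    [Module.Flat R Q] (n : ℕ) : Limits.IsZero ((usCx P.complex Q).homology (n + 1)) := by
  rw [← HomologicalComplex.exactAt_iff_isZero_homology,
    HomologicalComplex.exactAt_iff' _ (n + 2) (n + 1) n (by simp only [ChainComplex.prev]; rfl)
    (by simp)]
  have h := P.exact_succ n
  rw [ShortComplex.ShortExact.moduleCat_exact_iff_function_exact] at h ⊢
  exact Module.Flat.lTensor_exact Q h

/-- `H₀(X ⊗ P) ⟶ X ⊗ F`. -/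
def usH0 {F : ModuleCat.{u} R} (P : ProjectiveResolution F) (X : ModuleCat.{u} R) :
    (usCx P.complex X).homology 0 ⟶ MonoidalCategory.tensorObj X F :=
  (ChainComplex.isoHomologyι₀ _).hom ≫
    P.fromLeftDerivedZero' ((MonoidalCategory.tensoringLeft (ModuleCat.{u} R)).obj X)

instance {F : ModuleCat.{u} R} (P : ProjectiveResolution F) (X : ModuleCat.{u} R) :
    IsIso (usH0 P X) := by
  have : Limits.PreservesFiniteColimits
    ((MonoidalCategory.tensoringLeft (ModuleCat.{u} R)).obj X) :=
    inferInstanceAs (Limits.PreservesFiniteColimits (MonoidalCategory.tensorLeft X))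
  unfold usH0
  exact inferInstance

lemma usH0_naturality {F : ModuleCat.{u} R} (P : ProjectiveResolution F) {X Y : ModuleCat.{u} R}
    (f : X ⟶ Y) :
    HomologicalComplex.homologyMap (usCxMap P.complex f) 0 ≫ usH0 P Y =
      usH0 P X ≫ MonoidalCategory.whiskerRight f F := by
  have h : HomologicalComplex.opcyclesMap (usCxMap P.complex f) 0 ≫
      P.fromLeftDerivedZero' ((MonoidalCategory.tensoringLeft (ModuleCat.{u} R)).obj Y) =
      P.fromLeftDerivedZero' ((MonoidalCategory.tensoringLeft (ModuleCat.{u} R)).obj X) ≫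
        MonoidalCategory.whiskerRight f F := by
    rw [← cancel_epi (HomologicalComplex.pOpcycles _ _), HomologicalComplex.p_opcyclesMap_assoc]
    rw [ProjectiveResolution.pOpcycles_comp_fromLeftDerivedZero',
      ProjectiveResolution.pOpcycles_comp_fromLeftDerivedZero'_assoc]
    exact ((MonoidalCategory.tensoringLeft (ModuleCat.{u} R)).map f).naturality (P.π.f 0) |>.symm
  unfold usH0
  rw [Category.assoc, ← h]
  exact HomologicalComplex.homologyι_naturality_assoc (usCxMap P.complex f) 0 _



lemma IsUSTorsion.of_injective {S : Submonoid R} {M N : Type u} [AddCommGroup M] [Module R M]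
    [AddCommGroup N] [Module R N] (f : M →ₗ[R] N) (hf : Function.Injective f)
    (h : IsUSTorsion S N) : IsUSTorsion S M := by
  obtain ⟨s, hs, h⟩ := h
  exact ⟨s, hs, fun m => hf (by rw [map_smul, h, map_zero])⟩

lemma IsUSTorsion.of_mono {S : Submonoid R} {M N : ModuleCat.{u} R} (f : M ⟶ N) [Mono f]
    (h : IsUSTorsion S N) : IsUSTorsion S M :=
  IsUSTorsion.of_injective f.hom ((ModuleCat.mono_iff_injective f).1 inferInstance) h

lemma usTor_iff (S : Submonoid R) {F : ModuleCat.{u} R} (P : ProjectiveResolution F)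
    (M : ModuleCat.{u} R) (n : ℕ) :
    IsUSTorsion S (((Tor (ModuleCat.{u} R) n).obj M).obj F) ↔
      IsUSTorsion S ((usCx P.complex M).homology n) := by
  let e : ((Tor (ModuleCat.{u} R) n).obj M).obj F ≅ (usCx P.complex M).homology n :=
    P.isoLeftDerivedObj ((MonoidalCategory.tensoringLeft (ModuleCat.{u} R)).obj M) n
  exact ⟨fun h => IsUSTorsion.of_mono e.inv h, fun h => IsUSTorsion.of_mono e.hom h⟩

instance usFlat_X {F : ModuleCat.{u} R} (P : ProjectiveResolution F) (i : ℕ) :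
    Module.Flat R (P.complex.X i) := by
  have : Projective (P.complex.X i) := P.projective i
  have : Module.Projective R (P.complex.X i) :=
    (IsProjective.iff_projective (P.complex.X i)).2 this
  infer_instance

/-- Dimension shifting. -/
lemma usTor_shift (S : Submonoid R) {F : ModuleCat.{u} R} (P : ProjectiveResolution F)
    (T : ShortComplex (ModuleCat.{u} R)) (hT : T.ShortExact) [Module.Flat R T.X₂] (n : ℕ)
    (h : IsUSTorsion S ((usCx P.complex T.X₁).homology n)) :
    IsUSTorsion S ((usCx P.complex T.X₃).homology (n + 1)) := by
  have hT' := usSC_shortExact P.complex T hT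
  have := hT'.mono_δ (n + 1) n rfl (usCx_isZero P T.X₂ n)
  exact IsUSTorsion.of_mono (hT'.δ (n + 1) n rfl) h

lemma usH0_apply {F : ModuleCat.{u} R} (P : ProjectiveResolution F) {X Y : ModuleCat.{u} R}
    (f : X ⟶ Y) (x : (usCx P.complex X).homology 0) :
    usH0 P Y (HomologicalComplex.homologyMap (usCxMap P.complex f) 0 x) =
      LinearMap.rTensor F f.hom (usH0 P X x) :=
  ConcreteCategory.congr_hom (usH0_naturality P f) x

/-- `Tor₁` of the cokernel is torsion when the kernel of the tensored map is. -/
lemma usTor_one_of_ker (S : Submonoid R) {F : ModuleCat.{u} R} (P : ProjectiveResolution F)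
    (T : ShortComplex (ModuleCat.{u} R)) (hT : T.ShortExact) [Module.Flat R T.X₂]
    (h : ∃ s ∈ S, ∀ a ∈ LinearMap.ker (LinearMap.rTensor F T.f.hom), s • a = 0) :
    IsUSTorsion S ((usCx P.complex T.X₃).homology 1) := by
  have hT' := usSC_shortExact P.complex T hT
  have hm := hT'.mono_δ 1 0 rfl (usCx_isZero P T.X₂ 0)
  have hinj := (ModuleCat.mono_iff_injective _).1 hm
  have hinj0 := (ModuleCat.mono_iff_injective (usH0 P T.X₁)).1 inferInstance
  obtain ⟨s, hs, h⟩ := h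
  refine ⟨s, hs, fun m => hinj (hinj0 ?_)⟩
  rw [map_smul, map_smul, map_zero, map_zero]
  apply h
  rw [LinearMap.mem_ker]
  refine (usH0_apply P T.f _).symm.trans ?_
  have : HomologicalComplex.homologyMap (usCxMap P.complex T.f) 0 (hT'.δ 1 0 rfl m) = 0 :=
    ConcreteCategory.congr_hom (hT'.δ_comp 1 0 rfl) m
  rw [this, map_zero]

/-- The kernel of the tensored map is torsion when `Tor₁` of the cokernel is. -/
lemma usKer_of_tor_one (S : Submonoid R) {F : ModuleCat.{u} R} (P : ProjectiveResolution F)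
    (T : ShortComplex (ModuleCat.{u} R)) (hT : T.ShortExact)
    (h : IsUSTorsion S ((usCx P.complex T.X₃).homology 1)) :
    ∃ s ∈ S, ∀ a ∈ LinearMap.ker (LinearMap.rTensor F T.f.hom), s • a = 0 := by
  have hT' := usSC_shortExact P.complex T hT
  have hex := (ShortComplex.moduleCat_exact_iff _).1 (hT'.homology_exact₁ 1 0 rfl)
  have hsurj := (ModuleCat.epi_iff_surjective (usH0 P T.X₁)).1 inferInstance
  have hinj := (ModuleCat.mono_iff_injective (usH0 P T.X₂)).1 inferInstance
  obtain ⟨s, hs, h⟩ := h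
  refine ⟨s, hs, fun a ha => ?_⟩
  obtain ⟨x, rfl⟩ := hsurj a
  rw [LinearMap.mem_ker] at ha
  have hx : HomologicalComplex.homologyMap (usCxMap P.complex T.f) 0 x = 0 := by
    apply hinj
    rw [map_zero]
    exact (usH0_apply P T.f x).trans ha
  obtain ⟨y, hy⟩ := hex x hx
  have hy' : hT'.δ 1 0 rfl y = x := hy
  rw [← hy']
  have : s • usH0 P T.X₁ (hT'.δ 1 0 rfl y) = 0 := by
    rw [← map_smul, ← map_smul, h, map_zero, map_zero]
  exact this

section Elementary

open LinearMap TensorProduct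

variable {A B C F : Type u} [AddCommGroup A] [AddCommGroup B] [AddCommGroup C] [AddCommGroup F]
    [Module R A] [Module R B] [Module R C] [Module R F]

lemma usRange_rTensor {D : Type u} [AddCommGroup D] [Module R D] (f : A →ₗ[R] B) (k : D →ₗ[R] B)
    (s : R) (h : ∀ d, s • k d ∈ range f) (x : D ⊗[R] F) :
    s • rTensor F k x ∈ range (rTensor F f) := by
  induction x with
  | zero => simp
  | add x y hx hy => rw [map_add, smul_add]; exact add_mem hx hy
  | tmul d y =>
    obtain ⟨a, ha⟩ := h d
    exact ⟨a ⊗ₜ y, by rw [rTensor_tmul, rTensor_tmul, ha, TensorProduct.smul_tmul']⟩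

/-- (2) implies (1), elementwise. -/
lemma usShortExact_of_ker (S : Submonoid R)
    (H : ∀ (B : Type u) [AddCommGroup B] [Module R B] (N : Submodule R B),
      ∃ s ∈ S, ∀ a ∈ ker (rTensor F N.subtype), s • a = 0)
    (f : A →ₗ[R] B) (g : B →ₗ[R] C) (h : IsUSShortExact S f g) :
    IsUSShortExact S (rTensor F f) (rTensor F g) := by
  obtain ⟨⟨s₁, hs₁, h₁⟩, ⟨s₂, hs₂, h₂⟩, s, hs, h₃, h₄⟩ := h
  have key : ∀ {A B : Type u} [AddCommGroup A] [AddCommGroup B] [Module R A] [Module R B]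
      (f : A →ₗ[R] B), ∃ t ∈ S, ∀ x ∈ ker (rTensor F f),
        t • x ∈ range (rTensor F (ker f).subtype) := by
    intro A B _ _ _ _ f
    obtain ⟨t, ht, h⟩ := H B (range f)
    refine ⟨t, ht, fun x hx => ?_⟩
    have hex : Function.Exact (rTensor F (ker f).subtype) (rTensor F f.rangeRestrict) := by
      apply rTensor_exact
      · intro y
        simp [Subtype.ext_iff]
      · exact f.surjective_rangeRestrict
    refine (hex _).1 ?_
    rw [map_smul]
    apply h
    rw [mem_ker, ← LinearMap.comp_apply, ← rTensor_comp]
    exact hx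
  refine ⟨?_, ⟨s₂, hs₂, fun c => ?_⟩, ?_⟩
  · obtain ⟨t, ht, h⟩ := key f
    refine ⟨s₁ * t, S.mul_mem hs₁ ht, fun a ha => ?_⟩
    obtain ⟨y, hy⟩ := h a ha
    rw [mul_smul, ← hy]
    have := usRange_rTensor (F := F) (0 : A →ₗ[R] A) (ker f).subtype s₁
      (fun d => ⟨0, by simpa using (h₁ d d.2).symm⟩) y
    simpa using this
  · have := usRange_rTensor (F := F) g LinearMap.id s₂ (fun d => h₂ d) c
    simpa using this
  · obtain ⟨t, ht, h⟩ := key g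
    refine ⟨s * t, S.mul_mem hs ht, fun b hb => ?_, ?_⟩
    · obtain ⟨y, hy⟩ := h b hb
      rw [mul_smul, ← hy]
      exact usRange_rTensor f (ker g).subtype s (fun d => h₃ d d.2) y
    · rintro _ ⟨x, rfl⟩
      rw [mem_ker, map_smul, mul_comm, mul_smul, ← LinearMap.comp_apply, ← rTensor_comp, ← LinearMap.smul_apply,
        ← rTensor_smul]
      have : s • (g ∘ₗ f) = 0 := by
        ext a
        have := h₄ (f a) ⟨a, rfl⟩
        simpa using this
      simp [this]

end Elementary

end USHelpers

/-- Characterizations of `u`-`S`-flat modules: `F` is `u`-`S`-flat iff tensoring `F` with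
every short exact sequence gives a `u`-`S`-exact sequence, iff `Tor_1^R(M, F)` is
`u`-`S`-torsion for every `M`, iff `Tor_n^R(M, F)` is `u`-`S`-torsion for every `M`
and every `n ≥ 1`. -/
theorem isUSFlat_tfae {R : Type u} [CommRing R] (S : Submonoid R)
    (F : Type u) [AddCommGroup F] [Module R F] :
    (IsUSFlat S F ↔
      ∀ (A B C : Type u) [AddCommGroup A] [AddCommGroup B] [AddCommGroup C]
        [Module R A] [Module R B] [Module R C]
        (f : A →ₗ[R] B) (g : B →ₗ[R] C),
        Function.Injective f → Function.Surjective g → Function.Exact f g →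
          IsUSShortExact S (LinearMap.rTensor F f) (LinearMap.rTensor F g)) ∧
    (IsUSFlat S F ↔
      ∀ M : ModuleCat.{u} R,
        IsUSTorsion S (((Tor (ModuleCat.{u} R) 1).obj M).obj (ModuleCat.of R F))) ∧
    (IsUSFlat S F ↔
      ∀ (M : ModuleCat.{u} R) (n : ℕ), 1 ≤ n →
        IsUSTorsion S (((Tor (ModuleCat.{u} R) n).obj M).obj (ModuleCat.of R F))) := by
  have h12 : IsUSFlat S F →
      ∀ (A B C : Type u) [AddCommGroup A] [AddCommGroup B] [AddCommGroup C]
        [Module R A] [Module R B] [Module R C]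
        (f : A →ₗ[R] B) (g : B →ₗ[R] C),
        Function.Injective f → Function.Surjective g → Function.Exact f g →
          IsUSShortExact S (LinearMap.rTensor F f) (LinearMap.rTensor F g) := by
    intro h A B C _ _ _ _ _ _ f g hf hg hfg
    refine h A B C f g ⟨⟨1, S.one_mem, fun a ha => ?_⟩, ⟨1, S.one_mem, fun c => ?_⟩,
      1, S.one_mem, fun b hb => ?_, fun b hb => ?_⟩
    · rw [one_smul]; exact hf (by rw [LinearMap.mem_ker.1 ha, map_zero])
    · rw [one_smul]; exact hg c
    · rw [one_smul]; exact (hfg b).1 hb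
    · rw [one_smul]; exact (hfg b).2 hb
  have h21 : (∀ (B : Type u) [AddCommGroup B] [Module R B] (N : Submodule R B),
      ∃ s ∈ S, ∀ a ∈ LinearMap.ker (LinearMap.rTensor F N.subtype), s • a = 0) →
      IsUSFlat S F := by
    intro H A B C _ _ _ _ _ _ f g h
    exact usShortExact_of_ker S H f g h
  let P : ProjectiveResolution (ModuleCat.of R F) := projectiveResolution (ModuleCat.of R F)
  have h31 : (∀ M : ModuleCat.{u} R,
        IsUSTorsion S (((Tor (ModuleCat.{u} R) 1).obj M).obj (ModuleCat.of R F))) →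
      IsUSFlat S F := by
    intro H
    refine h21 fun B _ _ N => ?_
    let T : ShortComplex (ModuleCat.{u} R) := ModuleCat.shortComplexOfCompEqZero
      N.subtype N.mkQ (LinearMap.exact_subtype_mkQ N).linearMap_comp_eq_zero
    have hT : T.ShortExact := ModuleCat.shortComplex_shortExact T
      (LinearMap.exact_subtype_mkQ N) N.injective_subtype N.mkQ_surjective
    exact usKer_of_tor_one S P T hT ((usTor_iff S P _ 1).1 (H _))
  have h14 : IsUSFlat S F → ∀ (n : ℕ) (M : ModuleCat.{u} R),
        IsUSTorsion S ((usCx P.complex M).homology (n + 1)) := by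
    intro H n
    induction n with
    | zero =>
      intro M
      have hT := M.shortExact_projectiveShortComplex
      exact usTor_one_of_ker S P _ hT
        (h12 H _ _ _ _ _ hT.moduleCat_injective_f hT.moduleCat_surjective_g
          ((ShortComplex.ShortExact.moduleCat_exact_iff_function_exact _).1 hT.exact)).1
    | succ n ih =>
      intro M
      exact usTor_shift S P _ M.shortExact_projectiveShortComplex (n + 1) (ih _)
  have h14' : IsUSFlat S F → ∀ (M : ModuleCat.{u} R) (n : ℕ), 1 ≤ n →
        IsUSTorsion S (((Tor (ModuleCat.{u} R) n).obj M).obj (ModuleCat.of R F)) := by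
    intro H M n hn
    obtain ⟨k, rfl⟩ := Nat.exists_eq_add_of_le' hn
    exact (usTor_iff S P M (k + 1)).2 (h14 H k M)
  refine ⟨⟨h12, fun H => h21 fun B _ _ N => ?_⟩, ⟨fun H M => h14' H M 1 le_rfl, h31⟩,
    ⟨h14', fun H => h31 fun M => H M 1 le_rfl⟩⟩
  exact (H _ _ _ N.subtype N.mkQ N.injective_subtype N.mkQ_surjective
    (LinearMap.exact_subtype_mkQ N)).1
end

section
/- Let p be a prime, S = {p^n | n ≥ 0} ⊆ ℤ, and M = ℤ[1/p]/ℤ (the quotient of the localization of ℤ at S by ℤ, i.e., the Prüfer p-group). Then Tor_1^ℤ(ℤ/I, M) is u-S-torsion for every ideal I of ℤ, but Tor_1^ℤ(ℚ/ℤ, M) is not u-S-torsion; in particular M is not u-S-flat. -/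
set_option linter.unusedSimpArgs false
set_option linter.unusedSectionVars false

universe u v

open CategoryTheory

open TensorProduct

section
variable {R : Type} [CommRing R]

lemma aux_homology (S : ShortComplex (ModuleCat.{0} R)) (s : R) :
    (∀ m : S.homology, s • m = 0) ↔
      ∀ z : S.X₂, S.g.hom z = 0 → ∃ w, S.f.hom w = s • z := by
  let e := S.moduleCatHomologyIso.toLinearEquiv
  have h1 : (∀ m : S.homology, s • m = 0) ↔ ∀ m : S.moduleCatLeftHomologyData.H, s • m = 0 := by
    constructor
    · intro h m
      have := congrArg e (h (e.symm m))
      simpa using this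
    · intro h m
      apply e.injective
      rw [map_smul, h, map_zero]
  rw [h1]
  constructor
  · intro h z hz
    have : (Submodule.Quotient.mk (s • ⟨z, hz⟩ : LinearMap.ker S.g.hom) :
        _ ⧸ LinearMap.range S.moduleCatToCycles) = 0 := h (Submodule.Quotient.mk ⟨z, hz⟩)
    obtain ⟨w, hw⟩ := (Submodule.Quotient.mk_eq_zero _).1 this
    exact ⟨w, congrArg Subtype.val hw⟩
  · intro h m
    obtain ⟨⟨z, hz⟩, rfl⟩ := Submodule.Quotient.mk_surjective _ m
    obtain ⟨w, hw⟩ := h z hz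
    have : (Submodule.Quotient.mk (s • ⟨z, hz⟩ : LinearMap.ker S.g.hom) :
        _ ⧸ LinearMap.range S.moduleCatToCycles) = 0 :=
      (Submodule.Quotient.mk_eq_zero _).2 ⟨w, Subtype.ext hw⟩
    exact this

lemma aux_tor (X M : ModuleCat.{0} R) (P : ProjectiveResolution M) (s : R) :
    (∀ m : ((Tor (ModuleCat.{0} R) 1).obj X).obj M, s • m = 0) ↔
      ∀ z : TensorProduct R X (P.complex.X 1),
        LinearMap.lTensor X (P.complex.d 1 0).hom z = 0 →
        ∃ w, LinearMap.lTensor X (P.complex.d 2 1).hom w = s • z := by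
  let F := (MonoidalCategory.tensoringLeft (ModuleCat.{0} R)).obj X
  let K := (F.mapHomologicalComplex (ComplexShape.down ℕ)).obj P.complex
  let e : ((Tor (ModuleCat.{0} R) 1).obj X).obj M ≅ (K.sc' 2 1 0).homology :=
    P.isoLeftDerivedObj F 1 ≪≫ ShortComplex.homologyMapIso (K.isoSc' 2 1 0 (by simp) (by simp))
  let e' := e.toLinearEquiv
  have h1 : (∀ m : ((Tor (ModuleCat.{0} R) 1).obj X).obj M, s • m = 0) ↔
      ∀ m : (K.sc' 2 1 0).homology, s • m = 0 := by
    constructor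
    · intro h m
      have := congrArg e' (h (e'.symm m))
      rw [map_smul, map_zero, LinearEquiv.apply_symm_apply] at this
      exact this
    · intro h m
      apply e'.injective
      rw [map_smul, h, map_zero]
  rw [h1, aux_homology]
  exact Iff.rfl

lemma aux_quot {K : Type} [AddCommGroup K] [Module R K] (I : Ideal R) (x : K)
    (h : (Submodule.Quotient.mk 1 : R ⧸ I) ⊗ₜ[R] x = 0) : x ∈ I • (⊤ : Submodule R K) := by
  have := congrArg (TensorProduct.quotTensorEquivQuotSMul K I) h
  rw [map_zero] at this
  erw [TensorProduct.quotTensorEquivQuotSMul_mk_tmul] at this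
  simpa using this

lemma aux_smul {K : Type} [AddCommGroup K] [Module R K] (a : R) (x : K)
    (h : x ∈ (Ideal.span {a} : Ideal R) • (⊤ : Submodule R K)) : ∃ y, x = a • y := by
  rw [Submodule.ideal_span_singleton_smul] at h
  obtain ⟨y, -, rfl⟩ := h
  exact ⟨y, rfl⟩

end

section
variable {R : Type} [CommRing R] [IsDomain R] [IsPrincipalIdealRing R]
  (E : Type) [Field E] [Algebra R E] [IsFractionRing R E]

lemma aux_div (p : R) (hp : Prime p) {K : Type} [AddCommGroup K] [Module R K] [Module.Flat R K]
    (x : K) (h : (Submodule.Quotient.mk (1 / algebraMap R E p : E) : E ⧸ Submodule.span R {(1 : E)}) ⊗ₜ[R] x = 0) :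
    ∃ y, x = p • y := by
  have hp0 : algebraMap R E p ≠ 0 := by simpa using hp.ne_zero
  let t := LinearMap.toSpanSingleton R (E ⧸ Submodule.span R {(1 : E)})
    (Submodule.Quotient.mk (1 / algebraMap R E p : E))
  have hk : LinearMap.ker t = Ideal.span {p} := by
    ext n
    rw [LinearMap.mem_ker, LinearMap.toSpanSingleton_apply, ← Submodule.Quotient.mk_smul,
      Submodule.Quotient.mk_eq_zero, Submodule.mem_span_singleton, Ideal.mem_span_singleton]
    constructor
    · rintro ⟨a, ha⟩
      refine ⟨a, ?_⟩
      simp only [Algebra.smul_def, mul_one] at ha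
      field_simp at ha
      apply IsFractionRing.injective R E
      rw [map_mul, mul_comm, ← ha]
    · rintro ⟨a, rfl⟩
      refine ⟨a, ?_⟩
      simp only [Algebra.smul_def, mul_one]
      simp only [map_pow, map_mul, map_one, one_mul, mul_one]
      field_simp
  let q := (Ideal.span {p} : Submodule R R).liftQ t hk.ge
  have hq : Function.Injective q := by
    rw [← LinearMap.ker_eq_bot]
    exact Submodule.ker_liftQ_eq_bot _ _ _ hk.le
  apply aux_smul
  apply aux_quot
  apply Module.Flat.rTensor_preserves_injective_linearMap (M := K) q hq
  rw [LinearMap.rTensor_tmul, map_zero, ← h]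
  congr 1
  exact (Submodule.liftQ_apply _ _ _).trans (by simp [t])

end

section
variable {R : Type} [CommRing R] [IsDomain R] [IsPrincipalIdealRing R]

  
lemma aux_bdd (p : R) (hp : Prime p) (M : Type) [AddCommGroup M] [Module R M]
    (htor : ∀ m : M, ∃ j : ℕ, p ^ j • m = 0) (a : R) (ha : a ≠ 0) : ∃ k : ℕ, ∀ m : M, a • m = 0 → p ^ k • m = 0 := by
  have hf : FiniteMultiplicity p a := FiniteMultiplicity.of_not_isUnit hp.not_isUnit ha
  obtain ⟨b, hb, hpb⟩ := hf.exists_eq_pow_mul_and_not_dvd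
  refine ⟨multiplicity p a, fun m hm => ?_⟩
  obtain ⟨j, hj⟩ := htor m
  have hc : IsCoprime (p ^ j) b := ((Prime.coprime_iff_not_dvd hp).2 hpb).pow_left
  obtain ⟨u, v, huv⟩ := hc
  set k := multiplicity p a
  calc p ^ k • m = ((u * p ^ k) * p ^ j + v * a) • m := by
        congr 1
        rw [hb]
        linear_combination (-p ^ k) * huv
    _ = 0 := by rw [add_smul, mul_smul _ _ m, mul_smul v, hj, hm]; simp

lemma aux_part1 (p : R) (hp : Prime p) (M : Type) [AddCommGroup M] [Module R M]
    (htor : ∀ m : M, ∃ j : ℕ, p ^ j • m = 0) (I : Ideal R) : IsUSTorsion (Submonoid.powers p)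
    (((Tor (ModuleCat.{0} R) 1).obj (ModuleCat.of R (R ⧸ I))).obj (ModuleCat.of R M)) := by
  obtain ⟨P⟩ := HasProjectiveResolution.out (Z := ModuleCat.of R M)
  obtain ⟨a, rfl⟩ : ∃ a, I = Ideal.span {a} := ⟨_, (Ideal.span_singleton_generator I).symm⟩
  have hk : ∃ k : ℕ, ∀ f : P.complex.X 0, (P.π.f 0).hom (a • f) = 0 → ∃ f', a • f = a • f' ∧
      (P.π.f 0).hom (p ^ k • f') = 0 := by
    by_cases ha : a = 0
    · subst ha
      exact ⟨0, fun f _ => ⟨0, by simp, by rw [smul_zero, map_zero]⟩⟩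
    · obtain ⟨k, hk⟩ := aux_bdd p hp M htor a ha
      refine ⟨k, fun f hf => ⟨f, rfl, ?_⟩⟩
      rw [map_smul] at hf ⊢
      exact hk _ hf
  obtain ⟨k, hk⟩ := hk
  refine ⟨p ^ k, ⟨k, rfl⟩, (aux_tor _ _ P _).2 ?_⟩
  intro z hz
  have hz1 : ∀ z : TensorProduct R (R ⧸ Ideal.span {a}) (P.complex.X 1), ∃ x : P.complex.X 1, z = (Submodule.Quotient.mk 1 : R ⧸ Ideal.span {a}) ⊗ₜ[R] x := by
    intro z
    induction z using TensorProduct.induction_on with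
    | zero => exact ⟨0, by simp⟩
    | tmul r x =>
      obtain ⟨r, rfl⟩ := Submodule.Quotient.mk_surjective _ r
      refine ⟨r • x, ?_⟩
      rw [← TensorProduct.smul_tmul, ← Submodule.Quotient.mk_smul, smul_eq_mul, mul_one]
    | add z₁ z₂ h₁ h₂ =>
      obtain ⟨x₁, rfl⟩ := h₁
      obtain ⟨x₂, rfl⟩ := h₂
      exact ⟨x₁ + x₂, (TensorProduct.tmul_add _ _ _).symm⟩
  obtain ⟨x, rfl⟩ := hz1 z
  rw [LinearMap.lTensor_tmul] at hz
  obtain ⟨f, hf⟩ := aux_smul _ _ (aux_quot _ _ hz)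
  have e0 := (ShortComplex.moduleCat_exact_iff _).1 P.exact₀
  have e1 := (ShortComplex.moduleCat_exact_iff _).1 (P.exact_succ 0)
  have hπ : (P.π.f 0).hom (a • f) = 0 := by
    rw [← hf]
    exact ShortComplex.moduleCat_zero_apply (ShortComplex.mk _ _ P.complex_d_comp_π_f_zero) x
  obtain ⟨f', hf', hf''⟩ := hk f hπ
  obtain ⟨y, hy⟩ := e0 _ hf''
  obtain ⟨w, hw⟩ := e1 (p ^ k • x - a • y) (by
    change (P.complex.d 1 0).hom _ = 0
    change (P.complex.d 1 0).hom y = _ at hy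
    rw [map_sub, map_smul, map_smul, hy, hf, hf', smul_comm, sub_self])
  change (P.complex.d 2 1).hom w = _ at hw
  refine ⟨(Submodule.Quotient.mk 1) ⊗ₜ w, ?_⟩
  rw [LinearMap.lTensor_tmul, hw, TensorProduct.tmul_sub, TensorProduct.tmul_smul]
  have : (Submodule.Quotient.mk 1 : R ⧸ Ideal.span {a}) ⊗ₜ[R] (a • y) = 0 := by
    rw [← TensorProduct.smul_tmul, ← Submodule.Quotient.mk_smul,
      (Submodule.Quotient.mk_eq_zero _).2, TensorProduct.zero_tmul]
    simp [Ideal.mem_span_singleton]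
  erw [this]
  rw [sub_zero]

lemma aux_part2 (E : Type) [Field E] [Algebra R E] [IsFractionRing R E]
   (p : R) (hp : Prime p) (M : Type) [AddCommGroup M] [Module R M]
   
    (hord : ∀ n : ℕ, ∃ m : M, p ^ (n + 1) • m = 0 ∧ p ^ n • m ≠ 0) : ¬ IsUSTorsion (Submonoid.powers p)
    (((Tor (ModuleCat.{0} R) 1).obj (ModuleCat.of R (E ⧸ Submodule.span R {(1 : E)}))).obj
      (ModuleCat.of R M)) := by
  obtain ⟨P⟩ := HasProjectiveResolution.out (Z := ModuleCat.of R M)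
  rintro ⟨s, ⟨n, rfl⟩, hs⟩
  have hs' := (aux_tor _ _ P _).1 hs
  have hp0 : algebraMap R E p ≠ 0 := by simpa using hp.ne_zero
  obtain ⟨m, hm1, hm2⟩ := hord n
  have hsurj : Function.Surjective (P.π.f 0) := (ModuleCat.epi_iff_surjective _).1 inferInstance
  obtain ⟨f, hf⟩ := hsurj m
  change (P.π.f 0).hom f = m at hf
  have e0 := (ShortComplex.moduleCat_exact_iff _).1 P.exact₀
  obtain ⟨x, hx⟩ := e0 (p ^ (n + 1) • f) (by
    change (P.π.f 0).hom _ = 0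
    rw [map_smul, hf]; exact hm1)
  change (P.complex.d 1 0).hom x = _ at hx
  obtain ⟨w, hw⟩ := hs' ((Submodule.Quotient.mk (1 / algebraMap R E p ^ (n + 1) : E)) ⊗ₜ x) (by
    rw [LinearMap.lTensor_tmul, hx, ← TensorProduct.smul_tmul, ← Submodule.Quotient.mk_smul,
      (Submodule.Quotient.mk_eq_zero _).2, TensorProduct.zero_tmul]
    rw [Submodule.mem_span_singleton]
    refine ⟨1, ?_⟩
    simp only [Algebra.smul_def]
    simp only [map_pow, map_mul, map_one, one_mul, mul_one]
    field_simp)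
  have : Module.Projective R (P.complex.X 0) :=
    (IsProjective.iff_projective _).2 (P.projective 0)
  let d := (P.complex.d 1 0).hom
  have h2 := congrArg (LinearMap.lTensor (E ⧸ Submodule.span R {(1 : E)}) d.rangeRestrict) hw
  have hz : d.rangeRestrict ∘ₗ (P.complex.d 2 1).hom = 0 := by
    refine LinearMap.ext fun w => Subtype.ext ?_
    exact ShortComplex.moduleCat_zero_apply
      (ShortComplex.mk _ _ (P.complex.d_comp_d 2 1 0)) w
  erw [← LinearMap.lTensor_comp_apply] at h2
  rw [hz, LinearMap.lTensor_zero, LinearMap.zero_apply, map_smul] at h2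
  erw [LinearMap.lTensor_tmul] at h2
  rw [TensorProduct.smul_tmul', ← Submodule.Quotient.mk_smul] at h2
  have h3 : (p ^ n • (1 / algebraMap R E p ^ (n + 1) : E)) = 1 / algebraMap R E p := by
    simp only [Algebra.smul_def]
    simp only [map_pow, map_mul, map_one, one_mul, mul_one]
    field_simp
    rw [pow_succ]
  have : Module.Flat R (LinearMap.range d) := inferInstance
  obtain ⟨⟨_, ⟨y, rfl⟩⟩, hy⟩ := aux_div E p hp (d.rangeRestrict x) (by rw [← h3]; exact h2.symm)
  have hy' : d x = p • d y := congrArg Subtype.val hy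
  apply hm2
  have : p • (p ^ n • f - d y) = 0 := by
    rw [smul_sub, ← hy', smul_smul, ← pow_succ', ← hx, sub_self]
  rw [smul_eq_zero, or_iff_right hp.ne_zero, sub_eq_zero] at this
  rw [← hf]
  erw [← map_smul]
  rw [this]
  exact ShortComplex.moduleCat_zero_apply (ShortComplex.mk _ _ P.complex_d_comp_π_f_zero) y

lemma aux_part3 (E : Type) [Field E] [Algebra R E] [IsFractionRing R E]
   (p : R) (hp : Prime p) (M : Type) [AddCommGroup M] [Module R M]
    (htor : ∀ m : M, ∃ j : ℕ, p ^ j • m = 0)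
    (hord : ∀ n : ℕ, ∃ m : M, p ^ (n + 1) • m = 0 ∧ p ^ n • m ≠ 0) : ¬ IsUSFlat (Submonoid.powers p) M := by
  intro h
  have hp0 : algebraMap R E p ≠ 0 := by simpa using hp.ne_zero
  let f : R →ₗ[R] E := LinearMap.toSpanSingleton R E 1
  obtain ⟨⟨s, ⟨n, rfl⟩, hs⟩, -, -⟩ := h R E (E ⧸ LinearMap.range f) f (LinearMap.range f).mkQ
    ⟨⟨1, one_mem _, fun a ha => by
        have : a = 0 := by simpa [f] using ha
        simp [this]⟩,
      ⟨1, one_mem _, fun c => by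
        obtain ⟨x, rfl⟩ := Submodule.mkQ_surjective _ c
        exact ⟨x, by simp⟩⟩,
      ⟨1, one_mem _, fun b hb => by simpa using hb, fun b hb => by simpa using hb⟩⟩
  obtain ⟨m, -, hm⟩ := hord n
  obtain ⟨j, hj⟩ := htor m
  apply hm
  have := hs ((1 : R) ⊗ₜ m) (by
    rw [LinearMap.mem_ker, LinearMap.rTensor_tmul]
    have : f 1 = p ^ j • (1 / algebraMap R E p ^ j : E) := by
      simp only [Algebra.smul_def, f]
      simp only [map_pow, map_mul, map_one, one_mul, mul_one]
      field_simp
      simp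
    rw [this, TensorProduct.smul_tmul, hj, TensorProduct.tmul_zero])
  have := congrArg (TensorProduct.lid R M) this
  simpa using this

lemma aux_main (E : Type) [Field E] [Algebra R E] [IsFractionRing R E]
   (p : R) (hp : Prime p) (L : Type) [CommRing L] [Algebra R L] [IsLocalization (Submonoid.powers p) L] :
    (∀ I : Ideal R,
      IsUSTorsion (Submonoid.powers p)
        (((Tor (ModuleCat.{0} R) 1).obj (ModuleCat.of R (R ⧸ I))).obj
          (ModuleCat.of R (L ⧸
            Submodule.span R {(1 : L)})))) ∧
    ¬ IsUSTorsion (Submonoid.powers p)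
        (((Tor (ModuleCat.{0} R) 1).obj
            (ModuleCat.of R (E ⧸ Submodule.span R {(1 : E)}))).obj
          (ModuleCat.of R (L ⧸
            Submodule.span R {(1 : L)}))) ∧
    ¬ IsUSFlat (Submonoid.powers p)
        (L ⧸
          Submodule.span R {(1 : L)}) := by
  have hinj : Function.Injective (algebraMap R L) :=
    IsLocalization.injective _ (powers_le_nonZeroDivisors_of_noZeroDivisors hp.ne_zero)
  have htor : ∀ m : (L ⧸
      Submodule.span R {(1 : L)}), ∃ j : ℕ, p ^ j • m = 0 := by
    intro m
    obtain ⟨x, rfl⟩ := Submodule.Quotient.mk_surjective _ m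
    obtain ⟨⟨a, ⟨_, j, rfl⟩⟩, h⟩ := IsLocalization.surj (Submonoid.powers p) x
    refine ⟨j, ?_⟩
    rw [← Submodule.Quotient.mk_smul, Submodule.Quotient.mk_eq_zero, Submodule.mem_span_singleton]
    refine ⟨a, ?_⟩
    rw [Algebra.smul_def, Algebra.smul_def, mul_one, mul_comm _ x]
    exact h.symm
  have hord : ∀ n : ℕ, ∃ m : (L ⧸
      Submodule.span R {(1 : L)}),
      p ^ (n + 1) • m = 0 ∧ p ^ n • m ≠ 0 := by
    intro n
    obtain ⟨x, hx⟩ : ∃ x : L,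
        algebraMap R _ (p ^ (n + 1)) * x = 1 :=
      (IsLocalization.map_units L
        (⟨p ^ (n + 1), n + 1, rfl⟩ : Submonoid.powers p)).exists_right_inv
    refine ⟨Submodule.Quotient.mk x, ?_, ?_⟩
    · rw [← Submodule.Quotient.mk_smul, Submodule.Quotient.mk_eq_zero, Algebra.smul_def, hx]
      exact Submodule.mem_span_singleton_self _
    · rw [← Submodule.Quotient.mk_smul, Ne, Submodule.Quotient.mk_eq_zero,
        Submodule.mem_span_singleton]
      rintro ⟨a, ha⟩
      rw [Algebra.smul_def, Algebra.smul_def, mul_one] at ha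
      apply hp.not_isUnit
      refine IsUnit.of_mul_eq_one a (hinj ?_)
      rw [map_mul, ha, map_one, ← hx, pow_succ', map_mul]
      ring
  exact ⟨aux_part1 p hp _ htor, aux_part2 E p hp _ hord, aux_part3 E p hp _ htor hord⟩

end

/-- Let `p` be a prime, `S = {p^n | n ≥ 0} ⊆ ℤ` and `M = ℤ[1/p]/ℤ` (the Prüfer
`p`-group, realized as the localization of `ℤ` at `S` modulo the copy
`ℤ • 1 = span ℤ {1}` of `ℤ`). Then `Tor_1^ℤ(ℤ/I, M)` is `u`-`S`-torsion for every
ideal `I` of `ℤ`, but `Tor_1^ℤ(ℚ/ℤ, M)` is not `u`-`S`-torsion; in particular `M`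
is not `u`-`S`-flat. -/
theorem prufer_not_uSFlat (p : ℤ) (hp : Prime p) :
    (∀ I : Ideal ℤ,
      IsUSTorsion (Submonoid.powers p)
        (((Tor (ModuleCat.{0} ℤ) 1).obj (ModuleCat.of ℤ (ℤ ⧸ I))).obj
          (ModuleCat.of ℤ (Localization (Submonoid.powers p) ⧸
            Submodule.span ℤ {(1 : Localization (Submonoid.powers p))})))) ∧
    ¬ IsUSTorsion (Submonoid.powers p)
        (((Tor (ModuleCat.{0} ℤ) 1).obj
            (ModuleCat.of ℤ (ℚ ⧸ Submodule.span ℤ {(1 : ℚ)}))).obj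
          (ModuleCat.of ℤ (Localization (Submonoid.powers p) ⧸
            Submodule.span ℤ {(1 : Localization (Submonoid.powers p))}))) ∧
    ¬ IsUSFlat (Submonoid.powers p)
        (Localization (Submonoid.powers p) ⧸
          Submodule.span ℤ {(1 : Localization (Submonoid.powers p))}) := by
  have : @IsLocalization ℤ _ (Submonoid.powers p) (Localization (Submonoid.powers p)) _
      (Ring.toIntAlgebra _) := by
    convert (inferInstance : IsLocalization (Submonoid.powers p)
      (Localization (Submonoid.powers p)))
    exact Algebra.algebra_ext _ _ fun r => by
      rw [eq_intCast (@algebraMap ℤ (Localization (Submonoid.powers p)) _ _ (Ring.toIntAlgebra _)),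
        eq_intCast (@algebraMap ℤ (Localization (Submonoid.powers p)) _ _
          OreLocalization.instAlgebra)]
  let : Algebra ℤ (Localization (Submonoid.powers p)) := Ring.toIntAlgebra _
  exact aux_main ℚ p hp (Localization (Submonoid.powers p))
end

section
/- Let R be a commutative ring and S a multiplicative subset of R. The following are equivalent: (1) R is u-S-von Neumann regular, i.e., there exists s ∈ S such that for every a ∈ R there exists r ∈ R with s*a = r*a²; (2) there exists s ∈ S such that s • Tor_1^R(M, N) = 0 for all R-modules M and N; (3) there exists s ∈ S such that s • Tor_1^R(R/⟨a⟩, R/⟨a⟩) = 0 for every a ∈ R; (4) every R-module is u-S-flat. -/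
universe u v

open CategoryTheory

/-- A ring `R` is `u`-`S`-von Neumann regular if there exists `s ∈ S` such that
for every `a ∈ R` there is `r ∈ R` with `s * a = r * a ^ 2`. -/
def IsUSVonNeumannRegular {R : Type u} [CommRing R] (S : Submonoid R) : Prop :=
  ∃ s ∈ S, ∀ a : R, ∃ r : R, s * a = r * a ^ 2


open TensorProduct

theorem usvn_flat {K : Type u} [CommRing K] (h : ∀ a : K, ∃ r, a = r * a ^ 2)
    (M : Type v) [AddCommGroup M] [Module K M] : Module.Flat K M := by
  apply Module.flat_of_localized_maximal
  intro P hP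
  have hF : IsField (Localization.AtPrime P) := by
    rw [IsLocalRing.isField_iff_maximalIdeal_eq, eq_bot_iff]
    intro x hx
    have hx' : x ∈ nonunits _ := (IsLocalRing.mem_maximalIdeal x).1 hx
    obtain ⟨⟨a, t⟩, hat⟩ := IsLocalization.surj P.primeCompl x
    obtain ⟨r, hr⟩ := h a
    set φ := algebraMap K (Localization.AtPrime P) with hφ
    have hφa : φ a ∈ IsLocalRing.maximalIdeal (Localization.AtPrime P) := by
      rw [← hat]; exact Ideal.mul_mem_right _ _ hx
    have hu : IsUnit (1 - φ r * φ a) := by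
      by_contra hcon
      have h1 : (1 - φ r * φ a) ∈ IsLocalRing.maximalIdeal (Localization.AtPrime P) :=
        (IsLocalRing.mem_maximalIdeal _).2 hcon
      have h2 := Ideal.add_mem _ h1 (Ideal.mul_mem_left _ (φ r) hφa)
      rw [sub_add_cancel] at h2
      exact (IsLocalRing.maximalIdeal.isMaximal _).ne_top ((Ideal.eq_top_iff_one _).2 h2)
    have hz : (1 - φ r * φ a) * φ a = 0 := by
      have := congrArg φ hr
      rw [map_mul, map_pow] at this
      linear_combination this
    have ha0 : φ a = 0 := (hu.mul_right_eq_zero).1 hz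
    have ht : IsUnit (φ t) := IsLocalization.map_units _ t
    rw [Ideal.mem_bot]
    exact (ht.mul_left_eq_zero).1 (hat.trans ha0)
  rw [← Module.flat_iff_of_isLocalization (Localization.AtPrime P) P.primeCompl]
  let := hF.toField
  exact Module.Flat.of_free

theorem usvn_flat_loc {R : Type u} [CommRing R] {s : R} (h : ∀ a : R, ∃ r, s * a = r * a ^ 2)
    (M : Type v) [AddCommGroup M] [Module R M] :
    Module.Flat R (LocalizedModule (Submonoid.powers s) M) := by
  rw [← Module.flat_iff_of_isLocalization (Localization (Submonoid.powers s)) (Submonoid.powers s)]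
  apply usvn_flat
  intro x
  obtain ⟨⟨a, t⟩, hat⟩ := IsLocalization.surj (Submonoid.powers s) x
  obtain ⟨r, hr⟩ := h a
  set φ := algebraMap R (Localization (Submonoid.powers s)) with hφ
  have ht : IsUnit (φ t) := IsLocalization.map_units _ t
  have hs : IsUnit (φ s) := IsLocalization.map_units _ (⟨s, Submonoid.mem_powers s⟩ : Submonoid.powers s)
  obtain ⟨v, hv⟩ := hs.exists_left_inv
  refine ⟨v * φ r * φ t, ?_⟩
  apply ht.mul_right_cancel
  have := congrArg φ hr
  rw [map_mul, map_mul, map_pow, ← hat] at this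
  dsimp only at this
  linear_combination v * this - x * φ t * hv

theorem usvn_tors {R : Type u} [CommRing R] {s : R} (h : ∀ a : R, ∃ r, s * a = r * a ^ 2)
    {M : Type*} [AddCommGroup M] [Module R M] (x : M) (n : ℕ) (hx : s ^ n • x = 0) :
    s ^ 3 • x = 0 := by
  obtain ⟨r, hr⟩ := h (s ^ 2)
  have key : ∀ k : ℕ, s ^ 3 = r ^ k * s ^ (k + 3) := by
    intro k
    induction k with
    | zero => simp
    | succ k ih =>
      rw [ih] 
      linear_combination r ^ k * s ^ k * hr
  rw [key n, pow_add, ← mul_assoc, mul_right_comm, mul_smul, hx, smul_zero]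

theorem usvn_inj {R : Type u} [CommRing R] {s : R} (h : ∀ a : R, ∃ r, s * a = r * a ^ 2)
    (M : Type*) [AddCommGroup M] [Module R M] {A B : Type*} [AddCommGroup A] [AddCommGroup B]
    [Module R A] [Module R B] (f : A →ₗ[R] B) (hf : Function.Injective f) (x : M ⊗[R] A)
    (hx : f.lTensor M x = 0) : s ^ 3 • x = 0 := by
  have := usvn_flat_loc h M
  let g := LocalizedModule.mkLinearMap (Submonoid.powers s) M
  have h1 : g.rTensor A x = 0 := by
    apply Module.Flat.lTensor_preserves_injective_linearMap (M := LocalizedModule (Submonoid.powers s) M) f hf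
    rw [map_zero, ← LinearMap.comp_apply, LinearMap.lTensor_comp_rTensor,
      ← LinearMap.rTensor_comp_lTensor, LinearMap.comp_apply, hx, map_zero]
  have inst : IsLocalizedModule (Submonoid.powers s) (AlgebraTensorModule.rTensor R A g) := inferInstance
  have h2 : AlgebraTensorModule.rTensor R A g x = 0 := h1
  obtain ⟨⟨c, n, rfl⟩, hc⟩ := (IsLocalizedModule.eq_zero_iff (Submonoid.powers s) _).1 h2
  exact usvn_tors h x n hc

theorem usvn_key {R : Type u} [CommRing R] {s : R} (h : ∀ a : R, ∃ r, s * a = r * a ^ 2)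
    (M : Type*) [AddCommGroup M] [Module R M] {A B : Type*} [AddCommGroup A] [AddCommGroup B]
    [Module R A] [Module R B] (f : A →ₗ[R] B) (x : M ⊗[R] A)
    (hx : f.lTensor M x = 0) :
    s ^ 3 • x ∈ LinearMap.range ((LinearMap.ker f).subtype.lTensor M) := by
  have hex : Function.Exact (LinearMap.ker f).subtype f.rangeRestrict := by
    rw [LinearMap.exact_iff]; simp
  have h1 := lTensor_exact M hex f.surjective_rangeRestrict
  refine (h1 _).1 ?_
  rw [map_smul]
  refine usvn_inj h M (LinearMap.range f).subtype (Submodule.injective_subtype _) _ ?_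
  rw [← LinearMap.comp_apply, ← LinearMap.lTensor_comp]
  exact hx

theorem usvn_key' {R : Type u} [CommRing R] {s : R} (h : ∀ a : R, ∃ r, s * a = r * a ^ 2)
    (M : Type*) [AddCommGroup M] [Module R M] {A B : Type*} [AddCommGroup A] [AddCommGroup B]
    [Module R A] [Module R B] (f : A →ₗ[R] B) (x : A ⊗[R] M)
    (hx : f.rTensor M x = 0) :
    ∃ y, ((LinearMap.ker f).subtype.rTensor M) y = s ^ 3 • x := by
  obtain ⟨y, hy⟩ := usvn_key h M f (TensorProduct.comm R A M x) (by
    rw [← LinearMap.comm_comp_rTensor_comp_comm_eq]; simp [hx])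
  refine ⟨TensorProduct.comm R _ _ y, ?_⟩
  apply (TensorProduct.comm R A M).injective
  rw [map_smul, ← hy, ← LinearMap.comm_comp_rTensor_comp_comm_eq]
  simp

theorem usvn_smul_mem {R : Type u} [CommRing R] {s : R}
    (M : Type*) [AddCommGroup M] [Module R M] {A B C : Type*} [AddCommGroup A] [AddCommGroup B]
    [AddCommGroup C] [Module R A] [Module R B] [Module R C]
    (i : A →ₗ[R] C) (g : B →ₗ[R] C) (hs : ∀ c, s • i c ∈ LinearMap.range g) (x : A ⊗[R] M) :
    s • i.rTensor M x ∈ LinearMap.range (g.rTensor M) := by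
  induction x with
  | zero => simp
  | add x y hx hy => rw [map_add, smul_add]; exact add_mem hx hy
  | tmul c m =>
    obtain ⟨b, hb⟩ := hs c
    exact ⟨b ⊗ₜ m, by simp [hb, TensorProduct.smul_tmul']⟩

theorem usvn_one_four {R : Type u} [CommRing R] {S : Submonoid R} (h : IsUSVonNeumannRegular S)
    (M : Type v) [AddCommGroup M] [Module R M] : IsUSFlat S M := by
  obtain ⟨s, hsS, h⟩ := h
  rintro A B C _ _ _ _ _ _ f g ⟨⟨s1, hs1, h1⟩, ⟨s2, hs2, h2⟩, s3, hs3, h3, h3'⟩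
  refine ⟨⟨s1 * s ^ 3, S.mul_mem hs1 (S.pow_mem hsS 3), ?_⟩, ⟨s2, hs2, ?_⟩,
    s3 * s ^ 3, S.mul_mem hs3 (S.pow_mem hsS 3), ?_, ?_⟩
  · intro x hx
    obtain ⟨y, hy⟩ := usvn_key' h M f x hx
    rw [mul_smul, ← hy]
    have := usvn_smul_mem M (s := s1) (LinearMap.ker f).subtype (0 : A →ₗ[R] A)
      (fun c => by simp [h1 c.1 c.2]) y
    simpa using this
  · intro x
    have := usvn_smul_mem M (s := s2) (LinearMap.id) g h2 x
    simpa using this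
  · intro x hx
    obtain ⟨y, hy⟩ := usvn_key' h M g x hx
    rw [mul_smul, ← hy]
    exact usvn_smul_mem M (s := s3) (LinearMap.ker g).subtype f (fun c => h3 c.1 c.2) y
  · rintro _ ⟨y, rfl⟩
    rw [mul_comm, mul_smul]
    apply Submodule.smul_mem
    have := usvn_smul_mem M (s := s3) (g ∘ₗ f) (0 : A →ₗ[R] C)
      (fun c => by simpa using h3' (f c) ⟨c, rfl⟩) y
    rw [LinearMap.rTensor_comp] at this
    simpa using this

theorem usvn_four_one {R : Type u} [CommRing R] {S : Submonoid R}
    (h : ∀ (M : Type u) [AddCommGroup M] [Module R M], IsUSFlat S M) :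
    IsUSVonNeumannRegular S := by
  let A : Submodule R (R →₀ R) :=
    { carrier := {x | ∀ a, x a ∈ Ideal.span {a}}
      add_mem' := fun hx hy a => add_mem (hx a) (hy a)
      zero_mem' := fun a => zero_mem _
      smul_mem' := fun c x hx a => Ideal.mul_mem_left _ c (hx a) }
  obtain ⟨⟨s, hs, hk⟩, -⟩ := h ((R →₀ R) ⧸ A) A (R →₀ R) ((R →₀ R) ⧸ A) A.subtype A.mkQ
    ⟨⟨1, S.one_mem, fun a ha => by simpa using ha⟩,
     ⟨1, S.one_mem, fun c => by simp⟩,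
     1, S.one_mem, by simp, by simp⟩
  refine ⟨s, hs, fun a => ?_⟩
  have hsa : Finsupp.single a a ∈ A := by
    intro b
    by_cases hb : a = b
    · subst hb; simp
    · simp [hb]
  let x : A := ⟨Finsupp.single a a, hsa⟩
  have h0 := hk (x ⊗ₜ A.mkQ (Finsupp.single a 1)) (by
    rw [LinearMap.mem_ker, LinearMap.rTensor_tmul]
    have : A.subtype x = a • Finsupp.single a (1 : R) := by simp [x]
    rw [this, TensorProduct.smul_tmul, ← map_smul]
    have h2 : A.mkQ (a • Finsupp.single a (1 : R)) = 0 := by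
      rw [Submodule.mkQ_apply, Submodule.Quotient.mk_eq_zero]; simpa using hsa
    rw [h2, TensorProduct.tmul_zero])
  let q : R →ₗ[R] R ⧸ Ideal.span {a ^ 2} := (Ideal.span {a ^ 2}).mkQ
  let β : A →ₗ[R] ((R →₀ R) ⧸ A) →ₗ[R] (R ⧸ Ideal.span {a ^ 2}) :=
    LinearMap.flip (A.liftQ
      (((LinearMap.mul R R).compr₂ q).compl₁₂ (Finsupp.lapply a) (Finsupp.lapply a ∘ₗ A.subtype)) (by
        intro y hy
        rw [LinearMap.mem_ker]
        ext z
        have h1 := hy a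
        have h2 := z.2 a
        rw [Ideal.mem_span_singleton] at h1 h2
        have : y a * z.1 a ∈ Ideal.span {a ^ 2} := by
          rw [Ideal.mem_span_singleton, pow_two]; exact mul_dvd_mul h1 h2
        exact (Submodule.Quotient.mk_eq_zero _).2 this))
  have h3 := congrArg (TensorProduct.lift β) h0
  rw [map_smul, map_zero, TensorProduct.lift.tmul] at h3
  have h4 : β x (A.mkQ (Finsupp.single a 1)) = q a := by
    simp [β, x]
  rw [h4, ← map_smul] at h3
  have h5 := (Submodule.Quotient.mk_eq_zero _).1 h3
  obtain ⟨r, hr⟩ := Ideal.mem_span_singleton.1 h5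
  exact ⟨r, by rw [mul_comm r]; exact hr⟩

theorem usvn_homology {R : Type u} [CommRing R] (T : ShortComplex (ModuleCat.{u} R)) (s : R) :
    (∀ t : T.homology, s • t = 0) ↔
      ∀ x : T.X₂, T.g x = 0 → ∃ y : T.X₁, T.f y = s • x := by
  have hpi : Function.Surjective T.homologyπ :=
    (ModuleCat.epi_iff_surjective _).1 inferInstance
  have hi : Function.Injective T.iCycles :=
    (ModuleCat.mono_iff_injective _).1 inferInstance
  have hz : ∀ z : T.cycles, T.homologyπ z = 0 ↔ ∃ y, T.toCycles y = z := by
    intro z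
    have hE : (ShortComplex.mk T.toCycles T.homologyπ (by simp)).Exact :=
      ShortComplex.exact_of_g_is_cokernel _ T.homologyIsCokernel
    constructor
    · exact fun h => (ShortComplex.moduleCat_exact_iff _).1 hE z h
    · rintro ⟨y, rfl⟩
      rw [← ModuleCat.comp_apply]; simp
  constructor
  · intro h x hx
    let z : T.cycles := T.moduleCatCyclesIso.inv ⟨x, hx⟩
    have hzx : T.iCycles z = x := by
      have := congrArg (fun φ => φ.hom ⟨x, hx⟩) T.moduleCatCyclesIso_inv_iCycles
      exact this
    obtain ⟨y, hy⟩ := (hz (s • z)).1 (by rw [map_smul]; exact h _)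
    refine ⟨y, ?_⟩
    rw [← hzx, ← map_smul, ← hy, ← ModuleCat.comp_apply, ShortComplex.toCycles_i]
  · intro h t
    obtain ⟨z, rfl⟩ := hpi t
    obtain ⟨y, hy⟩ := h (T.iCycles z) (by rw [← ModuleCat.comp_apply]; simp)
    rw [← map_smul, hz]
    refine ⟨y, hi ?_⟩
    rw [map_smul, ← hy, ← ModuleCat.comp_apply, ShortComplex.toCycles_i]

theorem usvn_tor {R : Type u} [CommRing R] (M N : ModuleCat.{u} R) (P : ProjectiveResolution N)
    (s : R) :
    (∀ t : ((Tor (ModuleCat.{u} R) 1).obj M).obj N, s • t = 0) ↔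
      ∀ x : M ⊗[R] (P.complex.X 1), (P.complex.d 1 0).hom.lTensor M x = 0 →
        ∃ y : M ⊗[R] (P.complex.X 2), (P.complex.d 2 1).hom.lTensor M y = s • x := by
  let F := (MonoidalCategory.tensoringLeft (ModuleCat.{u} R)).obj M
  let K := (F.mapHomologicalComplex (ComplexShape.down ℕ)).obj P.complex
  let e1 : ((Tor (ModuleCat.{u} R) 1).obj M).obj N ≅ K.homology 1 := P.isoLeftDerivedObj F 1
  let e2 : K.homology 1 ≅ (K.sc' 2 1 0).homology :=
    ShortComplex.homologyMapIso (K.isoSc' 2 1 0 (by simp) (by simp))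
  let e := (e1 ≪≫ e2).toLinearEquiv
  have : (∀ t : ((Tor (ModuleCat.{u} R) 1).obj M).obj N, s • t = 0) ↔
      ∀ t : (K.sc' 2 1 0).homology, s • t = 0 := by
    constructor
    · intro h t
      apply e.symm.injective
      rw [map_smul, h, map_zero]
    · intro h t
      apply e.injective
      rw [map_smul, h, map_zero]
  rw [this, usvn_homology]
  exact Iff.rfl

theorem usvn_one_two {R : Type u} [CommRing R] {s : R} (h : ∀ a : R, ∃ r, s * a = r * a ^ 2)
    (M N : ModuleCat.{u} R) (t : ((Tor (ModuleCat.{u} R) 1).obj M).obj N) : s ^ 3 • t = 0 := by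
  let P := projectiveResolution N
  refine (usvn_tor M N P (s ^ 3)).2 ?_ t
  intro x hx
  obtain ⟨y, hy⟩ := usvn_key h M _ x hx
  have hE := (ShortComplex.moduleCat_exact_iff_range_eq_ker _).1 (P.exact_succ 0)
  let d2 := (P.complex.d 2 1).hom
  let d1 := (P.complex.d 1 0).hom
  have hE : LinearMap.range d2 = LinearMap.ker d1 := hE
  let j : P.complex.X 2 →ₗ[R] LinearMap.ker d1 :=
    d2.codRestrict _ (fun c => by rw [← hE]; exact ⟨c, rfl⟩)
  have hj : Function.Surjective j := by
    rintro ⟨c, hc⟩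
    rw [← hE] at hc
    obtain ⟨w, rfl⟩ := hc
    exact ⟨w, rfl⟩
  obtain ⟨w, rfl⟩ := LinearMap.lTensor_surjective M hj y
  refine ⟨w, ?_⟩
  rw [← hy, ← LinearMap.comp_apply, ← LinearMap.lTensor_comp]
  rfl

theorem usvn_three_one {R : Type u} [CommRing R] {s : R} (a : R)
    (h : ∀ t : ((Tor (ModuleCat.{u} R) 1).obj (ModuleCat.of R (R ⧸ Ideal.span {a}))).obj
          (ModuleCat.of R (R ⧸ Ideal.span {a})), s • t = 0) : ∃ r, s * a = r * a ^ 2 := by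
  let N := ModuleCat.of R (R ⧸ Ideal.span {a})
  let P := projectiveResolution N
  have h := (usvn_tor N N P s).1 h
  let d2 : P.complex.X 2 →ₗ[R] P.complex.X 1 := (P.complex.d 2 1).hom
  let d1 : P.complex.X 1 →ₗ[R] P.complex.X 0 := (P.complex.d 1 0).hom
  let ε : P.complex.X 0 →ₗ[R] (R ⧸ Ideal.span {a}) := (P.π.f 0).hom
  have hε : Function.Surjective ε := (ModuleCat.epi_iff_surjective (P.π.f 0)).1 inferInstance
  have hE : ∀ x, ε x = 0 → ∃ y, d1 y = x := (ShortComplex.moduleCat_exact_iff _).1 P.exact₀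
  have hεd : ∀ x, ε (d1 x) = 0 := fun x => by
    have := congrArg (fun φ => φ.hom x) P.complex_d_comp_π_f_zero
    exact this
  have hdd : ∀ x, d1 (d2 x) = 0 := fun x => by
    have := congrArg (fun φ => φ.hom x) (P.complex.d_comp_d 2 1 0)
    exact this
  have ha : ∀ y : R ⧸ Ideal.span {a}, a • y = 0 := by
    intro y
    obtain ⟨y, rfl⟩ := Submodule.mkQ_surjective _ y
    rw [← map_smul, Submodule.mkQ_apply, Submodule.Quotient.mk_eq_zero]
    exact Ideal.mul_mem_right _ _ (Ideal.mem_span_singleton_self a)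
  obtain ⟨p, hp⟩ := hε (Submodule.Quotient.mk 1)
  obtain ⟨q, hq⟩ := hE (a • p) (by rw [map_smul, ha])
  let o : R ⧸ Ideal.span {a} := Submodule.Quotient.mk 1
  obtain ⟨w, hw⟩ := h ((o : N) ⊗ₜ q) (by
    change (o : N) ⊗ₜ[R] d1 q = 0
    rw [hq, ← TensorProduct.smul_tmul]
    have : a • (o : N) = 0 := ha o
    rw [this, TensorProduct.zero_tmul])
  -- lift `w` to an element of `P₂`
  have hsurj : ∀ {X : Type u} [AddCommGroup X] [Module R X] (w : (R ⧸ Ideal.span {a}) ⊗[R] X),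
      ∃ v, o ⊗ₜ[R] v = w := by
    intro X _ _ w
    induction w with
    | zero => exact ⟨0, by simp⟩
    | add x y hx hy =>
      obtain ⟨v, rfl⟩ := hx
      obtain ⟨v', rfl⟩ := hy
      exact ⟨v + v', TensorProduct.tmul_add _ _ _⟩
    | tmul c v =>
      obtain ⟨c, rfl⟩ := Submodule.mkQ_surjective _ c
      refine ⟨c • v, ?_⟩
      rw [← TensorProduct.smul_tmul]
      congr 1
      change Submodule.Quotient.mk (c • (1 : R)) = _
      simp
  obtain ⟨v, hv⟩ := hsurj (X := P.complex.X 2) w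
  have hw' : o ⊗ₜ[R] d2 v = s • (o ⊗ₜ[R] q) := by
    rw [← hv] at hw; exact hw
  have hw2 : o ⊗ₜ[R] (s • q - d2 v) = 0 := by
    rw [TensorProduct.tmul_sub, hw', TensorProduct.tmul_smul, sub_self]
  -- hence `s • q - d2 v ∈ a • P₁`
  have hy : ∃ y, a • y = s • q - d2 v := by
    have h1 := congrArg (TensorProduct.quotTensorEquivQuotSMul (P.complex.X 1) (Ideal.span {a})) hw2
    have h2 : (Submodule.Quotient.mk (s • q - d2 v) :
        P.complex.X 1 ⧸ (Ideal.span {a} • (⊤ : Submodule R (P.complex.X 1)))) = 0 := by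
      rw [map_zero] at h1
      rw [← h1]
      change _ = TensorProduct.quotTensorEquivQuotSMul _ _ (Ideal.Quotient.mk _ 1 ⊗ₜ[R] _)
      rw [TensorProduct.quotTensorEquivQuotSMul_mk_tmul, one_smul]
    rw [Submodule.Quotient.mk_eq_zero, Submodule.ideal_span_singleton_smul] at h2
    obtain ⟨y, -, hy⟩ := h2
    exact ⟨y, hy⟩
  obtain ⟨y, hy⟩ := hy
  let z := s • p - d1 y
  have haz : a • z = 0 := by
    have := congrArg d1 hy
    rw [map_smul, map_sub, map_smul, hdd, hq, sub_zero] at this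
    simp only [z]
    rw [smul_sub, this, smul_comm, sub_self]
  have hproj : Module.Projective R (P.complex.X 0) :=
    (IsProjective.iff_projective _).2 (P.projective 0)
  obtain ⟨i, hi⟩ := hproj.out
  have hz1 : ε z = Submodule.Quotient.mk s := by
    simp only [z]
    rw [map_sub, hεd, map_smul, hp, sub_zero, ← Submodule.Quotient.mk_smul]
    simp
  have hann : ∀ j, a * i z j = 0 := by
    intro j
    have := congrArg (fun f => i f j) haz
    simpa using this
  let J : Submodule R (R ⧸ Ideal.span {a}) :=
    Submodule.map (Ideal.span {a}).mkQ (LinearMap.ker (LinearMap.mulLeft R a))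
  have hJ : ε z ∈ J := by
    rw [← hi z, Finsupp.linearCombination_apply, Finsupp.sum, map_sum]
    refine Submodule.sum_mem _ fun j _ => ?_
    rw [map_smul]
    obtain ⟨c, hc⟩ := Submodule.mkQ_surjective _ (ε (id j))
    rw [← hc, ← map_smul]
    refine ⟨_, ?_, rfl⟩
    simp only [SetLike.mem_coe, LinearMap.mem_ker, LinearMap.mulLeft_apply, smul_eq_mul]
    rw [← mul_assoc, hann, zero_mul]
  obtain ⟨c, hc, hcs⟩ := hJ
  rw [hz1, Submodule.mkQ_apply, Submodule.Quotient.eq, Ideal.mem_span_singleton] at hcs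
  obtain ⟨r, hr⟩ := hcs
  have hc' : a * c = 0 := hc
  exact ⟨-r, by linear_combination hc' - a * hr⟩

/-- `R` is `u`-`S`-von Neumann regular iff some `s ∈ S` kills `Tor_1^R(M, N)` for all
`R`-modules `M`, `N`, iff some `s ∈ S` kills `Tor_1^R(R/⟨a⟩, R/⟨a⟩)` for all `a ∈ R`,
iff every `R`-module is `u`-`S`-flat. -/
theorem isUSVonNeumannRegular_tfae {R : Type u} [CommRing R] (S : Submonoid R) :
    (IsUSVonNeumannRegular S ↔
      ∃ s ∈ S, ∀ M N : ModuleCat.{u} R,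
        ∀ t : ((Tor (ModuleCat.{u} R) 1).obj M).obj N, s • t = 0) ∧
    (IsUSVonNeumannRegular S ↔
      ∃ s ∈ S, ∀ a : R,
        ∀ t : ((Tor (ModuleCat.{u} R) 1).obj (ModuleCat.of R (R ⧸ Ideal.span {a}))).obj
          (ModuleCat.of R (R ⧸ Ideal.span {a})), s • t = 0) ∧
    (IsUSVonNeumannRegular S ↔
      ∀ (M : Type u) [AddCommGroup M] [Module R M], IsUSFlat S M) := by

  have h31 : (∃ s ∈ S, ∀ a : R,
        ∀ t : ((Tor (ModuleCat.{u} R) 1).obj (ModuleCat.of R (R ⧸ Ideal.span {a}))).obj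
          (ModuleCat.of R (R ⧸ Ideal.span {a})), s • t = 0) → IsUSVonNeumannRegular S :=
    fun ⟨s, hs, h⟩ => ⟨s, hs, fun a => usvn_three_one a (h a)⟩
  have h12 : IsUSVonNeumannRegular S → ∃ s ∈ S, ∀ M N : ModuleCat.{u} R,
        ∀ t : ((Tor (ModuleCat.{u} R) 1).obj M).obj N, s • t = 0 :=
    fun ⟨s, hs, h⟩ => ⟨s ^ 3, S.pow_mem hs 3, fun M N t => usvn_one_two h M N t⟩
  refine ⟨⟨h12, fun ⟨s, hs, h⟩ => h31 ⟨s, hs, fun a => h _ _⟩⟩, ⟨fun h => ?_, h31⟩,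
    ⟨fun h M _ _ => usvn_one_four h M, usvn_four_one⟩⟩
  obtain ⟨s, hs, h⟩ := h12 h
  exact ⟨s, hs, fun a => h _ _⟩
end
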